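/- Let $n\ge 1$, $0<\varepsilon\le 1/2$, and let $w:Q_1\to\mathbb{R}$ satisfy $|\nabla w(x)|\le \min\{1/\varepsilon, 1/|x_n|\}$ a.e. in $Q_1=(-1,1)^n$. For $x\in Q_1$ with $x_n>0$ set $R_x=\varepsilon$ if $x_n<\varepsilon$ and $R_x=x_n/2$ if $x_n\ge\varepsilon$. Then $\int_{Q_1\cap\{x_n>0\}}\int_{Q_1\cap B_{R_x}(x)}\frac{|w(x)-w(\bar x)|^2}{|x-\bar x|^{n+1}}\,d\bar x\,dx \le C|\log\varepsilon|$, with $C$ depending only on $n$. -/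

import Mathlib

open MeasureTheory Real Set

/-- The open unit cube `(-1,1)^d`. -/
def unitCube (d : ℕ) : Set (EuclideanSpace ℝ (Fin d)) := {x | ∀ i, |x i| < 1}

/-- Lipschitz bound on an open convex set from an a.e. gradient bound. -/
lemma lip_of_ae {d : ℕ} (w : EuclideanSpace ℝ (Fin d) → ℝ) (U : Set (EuclideanSpace ℝ (Fin d)))
    (hU : IsOpen U) (hc : Convex ℝ U) (M : ℝ)
    (hd : ∀ x ∈ U, DifferentiableAt ℝ w x)
    (hM : ∀ᵐ x : EuclideanSpace ℝ (Fin d), x ∈ U → ‖fderiv ℝ w x‖ ≤ M)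
    (x y : EuclideanSpace ℝ (Fin d)) (hx : x ∈ U) (hy : y ∈ U) :
    |w x - w y| ≤ M * ‖x - y‖ := by
  obtain ⟨h, rfl⟩ : ∃ h, y = x + h := ⟨y - x, by abel⟩
  have hmeas : MeasurableSet {z : EuclideanSpace ℝ (Fin d) | z ∈ U → ‖fderiv ℝ w z‖ ≤ M} := by
    have h1 : MeasurableSet {z : EuclideanSpace ℝ (Fin d) | ‖fderiv ℝ w z‖ ≤ M} :=
      measurableSet_le (measurable_fderiv ℝ w).norm measurable_const
    have h2 := hU.measurableSet.compl.union h1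
    convert h2 using 1
    ext z
    simp [imp_iff_not_or]
  have key : ∀ᵐ z : EuclideanSpace ℝ (Fin d), ∀ᵐ t : ℝ,
      (z + t • h ∈ U → ‖fderiv ℝ w (z + t • h)‖ ≤ M) := by
    rw [Measure.ae_ae_comm]
    · refine Filter.Eventually.of_forall fun t => ?_
      exact (measurePreserving_add_right volume (t • h)).quasiMeasurePreserving.ae hM
    · have : Measurable (fun p : EuclideanSpace ℝ (Fin d) × ℝ => p.1 + p.2 • h) := by fun_prop
      exact this hmeas
  have key2 : ∀ᵐ z : EuclideanSpace ℝ (Fin d), z ∈ U → z + h ∈ U →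
      |w z - w (z + h)| ≤ M * ‖h‖ := by
    filter_upwards [key] with z hz hzU hzhU
    have hseg : ∀ t ∈ uIcc (0:ℝ) 1, z + t • h ∈ U := by
      intro t ht
      rw [uIcc_of_le zero_le_one] at ht
      have := hc.add_smul_sub_mem hzU hzhU ht
      simpa using this
    have hder : ∀ t ∈ uIcc (0:ℝ) 1, HasDerivAt (fun t : ℝ => w (z + t • h))
        (fderiv ℝ w (z + t • h) h) t := by
      intro t ht
      have h1 : HasDerivAt (fun t : ℝ => z + t • h) h t := by
        simpa using ((hasDerivAt_id t).smul_const h).const_add z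
      exact (hd _ (hseg t ht)).hasFDerivAt.comp_hasDerivAt t h1
    have hb : ∀ᵐ t : ℝ, t ∈ Set.uIoc (0:ℝ) 1 → ‖fderiv ℝ w (z + t • h) h‖ ≤ M * ‖h‖ := by
      filter_upwards [hz] with t ht ht1
      have := ht (hseg t (uIoc_subset_uIcc ht1))
      exact ((fderiv ℝ w (z + t • h)).le_opNorm h).trans (by gcongr)
    have hint : IntervalIntegrable (fun t : ℝ => fderiv ℝ w (z + t • h) h) volume 0 1 := by
      rw [intervalIntegrable_iff]
      refine Measure.integrableOn_of_bounded (M := M * ‖h‖) (by simp [uIoc]) ?_ ?_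
      · have h1 : Measurable (fun t : ℝ => z + t • h) := by fun_prop
        exact ((measurable_fderiv_apply_const ℝ w h).comp h1).aestronglyMeasurable
      · rw [ae_restrict_iff' measurableSet_uIoc]
        exact hb
    have hF := intervalIntegral.integral_eq_sub_of_hasDerivAt hder hint
    have hN := intervalIntegral.norm_integral_le_of_norm_le_const_ae hb
    rw [hF] at hN
    simp only [one_smul, zero_smul, add_zero, sub_zero, abs_one, mul_one, Real.norm_eq_abs] at hN
    rwa [abs_sub_comm]
  have hdense : ∃ᶠ z in nhds x, (z ∈ U → z + h ∈ U → |w z - w (z + h)| ≤ M * ‖h‖) := by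
    exact mem_closure_iff_frequently.1 ((Measure.dense_of_ae key2) x)
  have e1 : ∀ᶠ z in nhds x, z ∈ U := hU.mem_nhds hx
  have hcont : Filter.Tendsto (fun z => z + h) (nhds x) (nhds (x + h)) :=
    (continuous_id.add continuous_const).tendsto x
  have e2 : ∀ᶠ z in nhds x, z + h ∈ U := hcont (hU.mem_nhds hy)
  have hfr := (hdense.and_eventually (e1.and e2)).mono
    (fun z hz => hz.1 hz.2.1 hz.2.2)
  have hlim : Filter.Tendsto (fun z => |w z - w (z + h)|) (nhds x) (nhds |w x - w (x + h)|) := by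
    refine Filter.Tendsto.abs (Filter.Tendsto.sub (hd x hx).continuousAt ?_)
    exact Filter.Tendsto.comp (hd _ hy).continuousAt hcont
  have := le_of_tendsto_of_frequently hlim hfr
  simpa using this

lemma isOpen_cube (d : ℕ) : IsOpen (unitCube d) := by
  have : unitCube d = ⋂ i, {x | |x i| < 1} := by ext; simp [unitCube]
  rw [this]
  refine isOpen_iInter_of_finite fun i => ?_
  exact isOpen_lt (by fun_prop) continuous_const

lemma convex_cube (d : ℕ) : Convex ℝ (unitCube d) := by
  intro x hx y hy a b ha hb hab i
  have h1 := abs_lt.1 (hx i)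
  have h2 := abs_lt.1 (hy i)
  have e : (a • x + b • y) i = a * x i + b * y i := by simp
  have : a = 1 - b := by linarith
  rw [e, abs_lt]
  have hh := (convex_Ioo (-1:ℝ) 1) (x := x i) h1 (y := y i) h2 ha hb hab
  simpa using hh

/-- The radial function. -/
lemma radial (n : ℕ) (R : ℝ) (hR : 0 < R) :
    Integrable (fun y : EuclideanSpace ℝ (Fin (n + 1)) =>
      (Iio R).indicator (fun r : ℝ => r ^ 2 / r ^ (n + 2)) ‖y‖) ∧
    ∫ y : EuclideanSpace ℝ (Fin (n + 1)),
      (Iio R).indicator (fun r : ℝ => r ^ 2 / r ^ (n + 2)) ‖y‖ =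
      (n + 1) * volume.real (Metric.ball (0 : EuclideanSpace ℝ (Fin (n + 1))) 1) * R := by
  have e : ∀ y ∈ Ioi (0:ℝ), y ^ (Module.finrank ℝ (EuclideanSpace ℝ (Fin (n + 1))) - 1) •
      (Iio R).indicator (fun r : ℝ => r ^ 2 / r ^ (n + 2)) y = (Iio R).indicator 1 y := by
    intro y hy
    have hy : 0 < y := hy
    by_cases h : y < R
    · simp [h]
      field_simp
      ring
    · simp [h]
  constructor
  · rw [integrable_fun_norm_addHaar volume
      (f := (Iio R).indicator (fun r : ℝ => r ^ 2 / r ^ (n + 2))),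
      integrableOn_congr_fun e measurableSet_Ioi, IntegrableOn,
      integrable_indicator_iff measurableSet_Iio, IntegrableOn,
      Measure.restrict_restrict measurableSet_Iio, Iio_inter_Ioi]
    exact integrableOn_const (by simp)
  · rw [integral_fun_norm_addHaar volume, setIntegral_congr_fun measurableSet_Ioi e,
      integral_indicator measurableSet_Iio, Measure.restrict_restrict measurableSet_Iio,
      Iio_inter_Ioi]
    simp [hR.le]
    ring

lemma inner_bound (n : ℕ) (w : EuclideanSpace ℝ (Fin (n + 1)) → ℝ)
    (x : EuclideanSpace ℝ (Fin (n + 1))) (A : Set (EuclideanSpace ℝ (Fin (n + 1))))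
    (hA : MeasurableSet A) (R K : ℝ) (hR : 0 < R)
    (hw : ∀ y ∈ A ∩ Metric.ball x R, |w x - w y| ≤ K * ‖x - y‖) :
    ∫ y in A ∩ Metric.ball x R, |w x - w y| ^ 2 / ‖x - y‖ ^ (n + 2) ≤
      K ^ 2 * ((n + 1) * volume.real (Metric.ball (0 : EuclideanSpace ℝ (Fin (n + 1))) 1) * R) := by
  obtain ⟨h1, h2⟩ := radial n R hR
  have h3 := integral_sub_left_eq_self (fun y : EuclideanSpace ℝ (Fin (n + 1)) =>
      (Iio R).indicator (fun r : ℝ => r ^ 2 / r ^ (n + 2)) ‖y‖) volume x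
  have h4 := (h1.comp_sub_left x).const_mul (K ^ 2)
  rw [← h2, ← integral_indicator (hA.inter measurableSet_ball), ← h3, ← integral_const_mul]
  refine integral_mono_of_nonneg ?_ h4 ?_
  · refine Filter.Eventually.of_forall fun y => indicator_nonneg (fun y _ => by positivity) _
  · refine Filter.Eventually.of_forall fun y => ?_
    by_cases hy : y ∈ A ∩ Metric.ball x R
    · have hlt : ‖x - y‖ < R := by
        have := hy.2
        rwa [Metric.mem_ball, dist_comm, dist_eq_norm] at this
      simp only [indicator_of_mem hy, indicator_of_mem (show ‖x - y‖ ∈ Iio R from hlt)]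
      rw [← mul_div_assoc, ← mul_pow]
      have := hw y hy
      gcongr
    · simp only [indicator_of_notMem hy]
      refine mul_nonneg (sq_nonneg _) ?_
      rw [indicator_apply]
      split_ifs <;> positivity

/-- The one-dimensional profile. -/
lemma profile (ε : ℝ) (h0 : 0 < ε) (h1 : ε ≤ 1 / 2) :
    Integrable ((Ioo (0:ℝ) 1).indicator (fun t => if t < ε then 1 / ε else 2 / t)) ∧
    ∫ t, (Ioo (0:ℝ) 1).indicator (fun t => if t < ε then 1 / ε else 2 / t) t
      = 1 + 2 * |Real.log ε| := by
  have e : (Ioo (0:ℝ) 1).indicator (fun t => if t < ε then 1 / ε else 2 / t) =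
      fun t => (Ioo (0:ℝ) ε).indicator (fun _ => 1 / ε) t +
        (Ico ε 1).indicator (fun t => 2 * (1 / t)) t := by
    ext t
    simp only [indicator, mem_Ioo, mem_Ico]
    split_ifs <;> first | (exfalso; grind) | ring
  have i1 : Integrable ((Ioo (0:ℝ) ε).indicator (fun _ => 1 / ε)) := by
    rw [integrable_indicator_iff measurableSet_Ioo]
    exact integrableOn_const (by simp)
  have i2 : Integrable ((Ico ε 1).indicator (fun t => 2 * (1 / t))) := by
    rw [integrable_indicator_iff measurableSet_Ico]
    refine (ContinuousOn.integrableOn_Icc ?_).mono_set Ico_subset_Icc_self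
    refine continuousOn_const.mul (continuousOn_const.div continuousOn_id ?_)
    intro t ht
    exact (h0.trans_le ht.1).ne'
  rw [e]
  refine ⟨i1.add i2, ?_⟩
  rw [integral_add i1 i2, integral_indicator measurableSet_Ioo,
    integral_indicator measurableSet_Ico, integral_Ico_eq_integral_Ioc,
    ← intervalIntegral.integral_of_le (by linarith), intervalIntegral.integral_const_mul,
    integral_one_div_of_pos h0 one_pos, abs_of_neg (Real.log_neg h0 (by linarith))]
  simp [h0.le, h0.ne']

lemma outer_int (n : ℕ) (g : ℝ → ℝ) (hg : Integrable ((Ioo (0:ℝ) 1).indicator g)) :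
    IntegrableOn (fun x : EuclideanSpace ℝ (Fin (n + 1)) => g (x (Fin.last n)))
      {x ∈ unitCube (n + 1) | 0 < x (Fin.last n)} ∧
    ∫ x in {x ∈ unitCube (n + 1) | 0 < x (Fin.last n)}, g (x (Fin.last n)) =
      2 ^ n * ∫ t, (Ioo (0:ℝ) 1).indicator g t := by
  have hS : MeasurableSet {x ∈ unitCube (n + 1) | 0 < x (Fin.last n)} := by
    have hop : IsOpen {x : EuclideanSpace ℝ (Fin (n + 1)) | 0 < x (Fin.last n)} :=
      isOpen_lt continuous_const (by fun_prop)
    exact (isOpen_cube _).measurableSet.inter hop.measurableSet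
  let f : Fin (n + 1) → ℝ → ℝ :=
    Fin.snoc (α := fun _ => ℝ → ℝ) (fun _ => (Ioo (-1:ℝ) 1).indicator 1) ((Ioo (0:ℝ) 1).indicator g)
  have hf : ∀ i, Integrable (f i) := by
    intro i
    refine Fin.lastCases ?_ (fun i => ?_) i
    · simpa [f] using hg
    · simp only [f, Fin.snoc_castSucc]
      rw [integrable_indicator_iff measurableSet_Ioo]
      exact integrableOn_const (by simp)
  have e : {x ∈ unitCube (n + 1) | 0 < x (Fin.last n)}.indicator
      (fun x : EuclideanSpace ℝ (Fin (n + 1)) => g (x (Fin.last n))) =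
      fun x => (fun v : Fin (n + 1) → ℝ => ∏ i, f i (v i)) (WithLp.ofLp x) := by
    ext x
    simp only [Fin.prod_univ_castSucc, f, Fin.snoc_castSucc, Fin.snoc_last]
    by_cases hx : x ∈ {x ∈ unitCube (n + 1) | 0 < x (Fin.last n)}
    · rw [indicator_of_mem hx]
      have a1 : x (Fin.last n) ∈ Ioo (0:ℝ) 1 := ⟨hx.2, (abs_lt.1 (hx.1 _)).2⟩
      have a2 : ∀ i : Fin n, x (Fin.castSucc i) ∈ Ioo (-1:ℝ) 1 := fun i => abs_lt.1 (hx.1 _)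
      rw [indicator_of_mem a1, Finset.prod_eq_one, one_mul]
      intro i _
      rw [indicator_of_mem (a2 i)]; rfl
    · rw [indicator_of_notMem hx]
      symm
      by_contra hne
      apply hx
      have hne := mul_ne_zero_iff.1 hne
      have b1 := mem_of_indicator_ne_zero hne.2
      have b2 := Finset.prod_ne_zero_iff.1 hne.1
      refine ⟨fun i => ?_, b1.1⟩
      refine Fin.lastCases ?_ (fun i => ?_) i
      · rw [abs_lt]; exact ⟨by linarith [b1.1], b1.2⟩
      · have b3 := mem_of_indicator_ne_zero (b2 i (Finset.mem_univ _))
        exact abs_lt.2 b3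
  have hmp := PiLp.volume_preserving_ofLp (Fin (n + 1))
  constructor
  · rw [← integrable_indicator_iff hS, e]
    exact hmp.integrable_comp_of_integrable (Integrable.fintype_prod hf)
  · rw [← integral_indicator hS, e, hmp.integral_comp
      (MeasurableEquiv.toLp 2 (Fin (n+1) → ℝ)).symm.measurableEmbedding,
      integral_fintype_prod_volume_eq_prod, Fin.prod_univ_castSucc]
    simp only [f, Fin.snoc_castSucc, Fin.snoc_last]
    congr 1
    simp [integral_indicator measurableSet_Ioo]
    norm_num

theorem stmt12 (n : ℕ) :
    ∃ C > 0, ∀ ε : ℝ, 0 < ε → ε ≤ 1 / 2 →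
      ∀ w : EuclideanSpace ℝ (Fin (n + 1)) → ℝ,
        (∀ x ∈ unitCube (n + 1), DifferentiableAt ℝ w x) →
        (∀ᵐ x : EuclideanSpace ℝ (Fin (n + 1)), x ∈ unitCube (n + 1) →
          ‖fderiv ℝ w x‖ ≤ min (1 / ε) (1 / |x (Fin.last n)|)) →
        (∫ x in {x ∈ unitCube (n + 1) | 0 < x (Fin.last n)},
          ∫ y in unitCube (n + 1) ∩
              Metric.ball x (if x (Fin.last n) < ε then ε else x (Fin.last n) / 2),
            |w x - w y| ^ 2 / ‖x - y‖ ^ (n + 2)) ≤ C * |Real.log ε| := by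
  set c : ℝ := (n + 1) * volume.real (Metric.ball (0 : EuclideanSpace ℝ (Fin (n + 1))) 1) with hc
  have hcpos : 0 < c := by
    have : 0 < volume.real (Metric.ball (0 : EuclideanSpace ℝ (Fin (n + 1))) 1) :=
      ENNReal.toReal_pos (Metric.measure_ball_pos _ _ one_pos).ne' measure_ball_lt_top.ne
    positivity
  have hl2 : 0 < Real.log 2 := Real.log_pos (by norm_num)
  refine ⟨c * (2 ^ n * (1 / Real.log 2 + 2)), by positivity, ?_⟩
  intro ε h0 h1 w hd hM
  obtain ⟨p1, p2⟩ := profile ε h0 h1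
  obtain ⟨o1, o2⟩ := outer_int n _ p1
  have hS : MeasurableSet {x ∈ unitCube (n + 1) | 0 < x (Fin.last n)} := by
    have hop : IsOpen {x : EuclideanSpace ℝ (Fin (n + 1)) | 0 < x (Fin.last n)} :=
      isOpen_lt continuous_const (by fun_prop)
    exact (isOpen_cube _).measurableSet.inter hop.measurableSet
  have hlog : 1 ≤ 1 / Real.log 2 * |Real.log ε| := by
    rw [abs_of_neg (Real.log_neg h0 (by linarith))]
    have : Real.log ε ≤ Real.log (1 / 2) := Real.log_le_log h0 h1
    rw [one_div, Real.log_inv] at this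
    rw [one_div, ← div_eq_inv_mul, le_div_iff₀ hl2]
    linarith
  calc _ ≤ ∫ x in {x ∈ unitCube (n + 1) | 0 < x (Fin.last n)},
        c * (if x (Fin.last n) < ε then 1 / ε else 2 / x (Fin.last n)) := by
        refine integral_mono_of_nonneg ?_ (o1.const_mul c) ?_
        · refine Filter.Eventually.of_forall fun x => ?_
          exact integral_nonneg fun y => by positivity
        · rw [Filter.EventuallyLE, ae_restrict_iff' hS]
          refine Filter.Eventually.of_forall fun x hx => ?_
          have hx0 : 0 < x (Fin.last n) := hx.2
          dsimp only
          split_ifs with hlt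
          · refine (inner_bound n w x _ (isOpen_cube _).measurableSet ε (1 / ε) h0 ?_).trans ?_
            · intro y hy
              refine lip_of_ae w _ (isOpen_cube _) (convex_cube _) _ hd ?_ x y hx.1 hy.1
              filter_upwards [hM] with z hz hzU
              exact (hz hzU).trans (min_le_left _ _)
            · rw [← hc]
              apply le_of_eq
              field_simp
          · refine (inner_bound n w x _ (isOpen_cube _).measurableSet (x (Fin.last n) / 2)
              (2 / x (Fin.last n)) (by positivity) ?_).trans ?_
            · intro y hy
              have hopen : IsOpen {z : EuclideanSpace ℝ (Fin (n + 1)) |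
                  x (Fin.last n) / 2 < z (Fin.last n)} :=
                isOpen_lt continuous_const (by fun_prop)
              have hconv : Convex ℝ {z : EuclideanSpace ℝ (Fin (n + 1)) |
                  x (Fin.last n) / 2 < z (Fin.last n)} := by
                refine convex_halfSpace_gt (f := fun z : EuclideanSpace ℝ (Fin (n + 1)) =>
                  z (Fin.last n)) ⟨fun _ _ => by simp, fun _ _ => by simp⟩ _
              refine lip_of_ae w (unitCube (n + 1) ∩ {z : EuclideanSpace ℝ (Fin (n + 1)) |
                  x (Fin.last n) / 2 < z (Fin.last n)}) ((isOpen_cube _).inter hopen)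
                ((convex_cube _).inter hconv) _ (fun z hz => hd z hz.1) ?_ x y
                ⟨hx.1, by simp only [mem_ofPred_eq]; linarith⟩ ⟨hy.1, ?_⟩
              · filter_upwards [hM] with z hz hzU
                refine ((hz hzU.1).trans (min_le_right _ _)).trans ?_
                have h3 : x (Fin.last n) / 2 < z (Fin.last n) := hzU.2
                rw [abs_of_pos (by linarith), div_le_div_iff₀ (by linarith) hx0]
                linarith
              · have h3 := hy.2
                rw [Metric.mem_ball, dist_comm, dist_eq_norm] at h3
                have h4 := PiLp.norm_apply_le (x - y) (Fin.last n)
                rw [Real.norm_eq_abs] at h4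
                have h5 := le_abs_self ((x - y) (Fin.last n))
                have h6 : (x - y) (Fin.last n) = x (Fin.last n) - y (Fin.last n) := by simp
                simp only [mem_ofPred_eq]
                linarith
            · rw [← hc]
              apply le_of_eq
              field_simp
              
    _ = c * (2 ^ n * (1 + 2 * |Real.log ε|)) := by
        rw [integral_const_mul, o2, p2]
    _ ≤ c * (2 ^ n * (1 / Real.log 2 * |Real.log ε| + 2 * |Real.log ε|)) := by gcongr
    _ = _ := by ring
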